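/- arXiv:2106.03045 — 2 statements merged into one kernel-verified Lean document; each statement's English description precedes it below -/
import Mathlib

section
/- Let α, β, γ, δ ∈ ℝ with α + δ ≠ 0 and αγ = 0. For the Lie algebra 𝔤₇ with its canonical connection ∇^c, the symmetrized Ricci tensor ρ̃^c of ∇^c is a Codazzi tensor for ∇^c if and only if α = 0 and γ = 0 (and hence δ ≠ 0). -/
noncomputable section

/-- The underlying vector space `V = ℝ³`. -/
abbrev V : Type := Fin 3 → ℝ

/-- The basis vector e₁. -/
def e1 : V := ![1, 0, 0]
/-- The basis vector e₂. -/
def e2 : V := ![0, 1, 0]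
/-- The basis vector e₃. -/
def e3 : V := ![0, 0, 1]

/-- The Lorentzian inner product with g(e₁,e₁)=g(e₂,e₂)=1, g(e₃,e₃)=−1. -/
def gL (x y : V) : ℝ := x 0 * y 0 + x 1 * y 1 - x 2 * y 2

/-- Curvature R(X,Y)Z = ∇_X ∇_Y Z − ∇_Y ∇_X Z − ∇_{[X,Y]} Z. -/
def curv (nabla bracket : V → V → V) (x y z : V) : V :=
  nabla x (nabla y z) - nabla y (nabla x z) - nabla (bracket x y) z

/-- Ricci tensor ρ(X,Y) = −g(R(X,e₁)Y,e₁) − g(R(X,e₂)Y,e₂) + g(R(X,e₃)Y,e₃). -/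
def ricci (nabla bracket : V → V → V) (x y : V) : ℝ :=
  - gL (curv nabla bracket x e1 y) e1 - gL (curv nabla bracket x e2 y) e2
  + gL (curv nabla bracket x e3 y) e3

/-- Symmetrized Ricci tensor ρ̃(X,Y) = (ρ(X,Y) + ρ(Y,X))/2. -/
def ricciSym (nabla bracket : V → V → V) (x y : V) : ℝ :=
  (ricci nabla bracket x y + ricci nabla bracket y x) / 2

/-- Covariant derivative of a (left-invariant) bilinear form:
(∇_X ω)(Y,Z) = −ω(∇_X Y, Z) − ω(Y, ∇_X Z). -/
def covDer (nabla : V → V → V) (ω : V → V → ℝ) (x y z : V) : ℝ :=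
  - ω (nabla x y) z - ω y (nabla x z)

/-- ω is a Codazzi tensor for ∇: (∇_X ω)(Y,Z) = (∇_Y ω)(X,Z) for all X,Y,Z. -/
def IsCodazzi (nabla : V → V → V) (ω : V → V → ℝ) : Prop :=
  ∀ x y z : V, covDer nabla ω x y z = covDer nabla ω y x z

/-- Torsion T(X,Y) = ∇_X Y − ∇_Y X − [X,Y]. -/
def torsion (nabla bracket : V → V → V) (x y : V) : V :=
  nabla x y - nabla y x - bracket x y

/-- (V,∇,ω) is a quasi-statistical structure:
(∇_X ω)(Y,Z) − (∇_Y ω)(X,Z) + ω(T(X,Y),Z) = 0 for all X,Y,Z. -/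
def IsQuasiStatistical (nabla bracket : V → V → V) (ω : V → V → ℝ) : Prop :=
  ∀ x y z : V,
    covDer nabla ω x y z - covDer nabla ω y x z + ω (torsion nabla bracket x y) z = 0

/-- The Lie bracket of the Lie algebra 𝔤7. -/
def bracket (α β γ δ : ℝ) (x y : V) : V :=
  ![ (x 0 * y 1 - x 1 * y 0) * (-α) + (x 0 * y 2 - x 2 * y 0) * (α) + (x 1 * y 2 - x 2 * y 1) * (γ),
     (x 0 * y 1 - x 1 * y 0) * (-β) + (x 0 * y 2 - x 2 * y 0) * (β) + (x 1 * y 2 - x 2 * y 1) * (δ),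
     (x 0 * y 1 - x 1 * y 0) * (-β) + (x 0 * y 2 - x 2 * y 0) * (β) + (x 1 * y 2 - x 2 * y 1) * (δ) ]

/-- The canonical connection ∇^c of 𝔤7. -/
def nabla (α β γ δ : ℝ) (x y : V) : V :=
  ![ x 0 * y 1 * (-α) + x 1 * y 1 * (-β) + x 2 * y 1 * (β-γ/2),
     x 0 * y 0 * (α) + x 1 * y 0 * (β) + x 2 * y 0 * (γ/2-β),
     (0:ℝ) ]

theorem stmt18 (α β γ δ : ℝ) (h1 : α + δ ≠ 0) (h2 : α * γ = 0) :
    IsCodazzi (nabla α β γ δ) (ricciSym (nabla α β γ δ) (bracket α β γ δ)) ↔ (α = 0 ∧ γ = 0) := by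
  constructor
  · intro h
    have h131 := h e1 e3 e1
    have h231 := h e2 e3 e1
    have h233 := h e2 e3 e3
    simp [covDer, ricciSym, ricci, curv, gL, nabla, bracket, e1, e2, e3] at h131 h231 h233
    have hα : α = 0 := by
      have : α ^ 3 = 0 := by linear_combination h131 - β / 2 * h2
      exact pow_eq_zero_iff (by norm_num) |>.mp this
    subst hα
    have hδ : δ ≠ 0 := by simpa using h1
    have hβγ : β * γ = 0 := by
      have : (β * γ) ^ 2 = 0 := by linear_combination (-4) * γ * h231
      exact pow_eq_zero_iff (by norm_num) |>.mp this
    have hγ : δ * γ ^ 2 = 0 := by linear_combination 4 * h233 + 2 * δ * hβγ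
    exact ⟨rfl, by simpa [hδ] using hγ⟩
  · rintro ⟨rfl, rfl⟩ x y z
    simp [covDer, ricciSym, ricci, curv, gL, nabla, bracket, e1, e2, e3]
    ring

end
end

section
/- Let α, β, γ, δ ∈ ℝ with α + δ ≠ 0 and αγ = 0. For the Lie algebra 𝔤₇ with its canonical connection ∇^c and symmetrized Ricci tensor ρ̃^c, the triple (𝔤₇, ∇^c, ρ̃^c) is a quasi-statistical structure if and only if α = 0 and γ = 0 (and hence δ ≠ 0). -/
noncomputable section

/-- The symmetrized Ricci tensor of the canonical connection of 𝔤7, in coordinates. -/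
theorem ricciSym_nabla_bracket (α β γ δ : ℝ) (x y : V) :
    ricciSym (nabla α β γ δ) (bracket α β γ δ) x y =
      -(α ^ 2 + β * γ / 2) * (x 0 * y 0 + x 1 * y 1)
        - (α * γ + δ * γ / 2) / 2 * (x 0 * y 2 + x 2 * y 0)
        + (α ^ 2 + β * γ / 2) / 2 * (x 1 * y 2 + x 2 * y 1) := by
  simp [ricciSym, ricci, curv, gL, nabla, bracket, e1, e2, e3]
  ring

theorem stmt19 (α β γ δ : ℝ) (h1 : α + δ ≠ 0) (h2 : α * γ = 0) :
    IsQuasiStatistical (nabla α β γ δ) (bracket α β γ δ) (ricciSym (nabla α β γ δ) (bracket α β γ δ)) ↔ (α = 0 ∧ γ = 0) := by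
  constructor
  · intro h
    have h121 := h e1 e2 e1
    have h122 := h e1 e2 e2
    have h131 := h e1 e3 e1
    have h233 := h e2 e3 e3
    simp only [covDer, ricciSym_nabla_bracket] at h121 h122 h131 h233
    simp [torsion, nabla, bracket, e1, e2, e3] at h121 h122 h131 h233
    have hβD : (α * γ + δ * γ / 2) * β = 0 := mul_eq_zero.mpr h121
    have hβA : (α ^ 2 + β * γ / 2) * β = 0 := mul_eq_zero.mpr h122
    have hα : α = 0 := by
      have key : α ^ 4 = 0 := by
        linear_combination 2 * α * h131 - α * hβD - α * β / 2 * h2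
      exact pow_eq_zero_iff (by norm_num) |>.mp key
    subst hα
    have hδ : δ ≠ 0 := by simpa using h1
    refine ⟨rfl, ?_⟩
    have hβγ : β * γ = 0 := by
      have key : (β * γ) ^ 2 = 0 := by linear_combination 2 * γ * hβA
      exact pow_eq_zero_iff (by norm_num) |>.mp key
    have key : δ * γ ^ 2 = 0 := by linear_combination 4 * h233 + δ * hβγ
    simpa [hδ] using key
  · rintro ⟨rfl, rfl⟩ x y z
    simp [covDer, ricciSym_nabla_bracket]

end
end
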